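/- (Finite-horizon form of Theorem 3.) Let (X, Y, Z) be finite-alphabet stochastic processes on a common probability space that are jointly stationary and jointly d-Markov. Then for every n ≥ 1, every k₁ ≥ 1, and every k₂ ≥ d, the causally conditioned partial directed information, directed information, and truncated directed information satisfy I_P^{(k₁)}(Y^n → X^n || Z^n) ≤ I(Y^n → X^n || Z^n) ≤ I_T^{(k₂)}(Y^n → X^n || Z^n). -/

import Mathlib

open MeasureTheory Finset

noncomputable section

variable {Ω : Type*}

/-- Windowed history `(X_{max(a,1)}, …, X_b)` of a process `X = (X_i)_{i ≥ 1}`, encoded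
uniformly as a map `ℕ → Option α`; indices outside the window `[max(a,1), b]` (in
particular, indices below `1`) are dropped (set to `none`). -/
def blk {α : Type*} (X : ℕ → Ω → α) (a b : ℕ) : Ω → (ℕ → Option α) :=
  fun ω j => if max a 1 ≤ j ∧ j ≤ b then some (X j ω) else none

/-- Shannon entropy `H(U)` of a random variable `U`. -/
def ent [MeasurableSpace Ω] {β : Type*} (μ : Measure Ω) (U : Ω → β) : ℝ :=
  -∑' b : β, (μ (U ⁻¹' {b})).toReal * Real.log (μ (U ⁻¹' {b})).toReal

/-- Conditional Shannon entropy `H(U ∣ V)`. -/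
def condEnt [MeasurableSpace Ω] {β γ : Type*} (μ : Measure Ω) (U : Ω → β) (V : Ω → γ) : ℝ :=
  ent μ (fun ω => (U ω, V ω)) - ent μ V

/-- Conditional mutual information `I(U ; V ∣ W) = H(U ∣ W) - H(U ∣ V, W)`. -/
def cmi [MeasurableSpace Ω] {β γ δ : Type*} (μ : Measure Ω) (U : Ω → β) (V : Ω → γ)
    (W : Ω → δ) : ℝ :=
  condEnt μ U W - condEnt μ U (fun ω => (V ω, W ω))

/-- `U` and `V` are conditionally independent given `W` (under `μ`). -/
def CondIndepRV [MeasurableSpace Ω] {β γ δ : Type*} (μ : Measure Ω) (U : Ω → β) (V : Ω → γ)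
    (W : Ω → δ) : Prop :=
  ∀ (b : β) (c : γ) (w : δ),
    μ (U ⁻¹' {b} ∩ V ⁻¹' {c} ∩ W ⁻¹' {w}) * μ (W ⁻¹' {w})
      = μ (U ⁻¹' {b} ∩ W ⁻¹' {w}) * μ (V ⁻¹' {c} ∩ W ⁻¹' {w})

variable {𝒳 𝒴 𝒵 : Type*}

/-- The joint past window `(X_{i-d}^{i-1}, Y_{i-d}^{i-1}, Z_{i-d}^{i-1})`. -/
def past (X : ℕ → Ω → 𝒳) (Y : ℕ → Ω → 𝒴) (Z : ℕ → Ω → 𝒵) (d i : ℕ) :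
    Ω → (ℕ → Option 𝒳) × (ℕ → Option 𝒴) × (ℕ → Option 𝒵) :=
  fun ω => (blk X (i - d) (i - 1) ω, blk Y (i - d) (i - 1) ω, blk Z (i - d) (i - 1) ω)

/-- `(X, Y, Z)` are jointly `d`-Markov: for every `i`, `(X_i, Y_i, Z_i)` is conditionally
independent of `(X^{i-d-1}, Y^{i-d-1}, Z^{i-d-1})` given
`(X_{i-d}^{i-1}, Y_{i-d}^{i-1}, Z_{i-d}^{i-1})`. -/
def JointlyMarkov [MeasurableSpace Ω] (μ : Measure Ω) (X : ℕ → Ω → 𝒳) (Y : ℕ → Ω → 𝒴)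
    (Z : ℕ → Ω → 𝒵) (d : ℕ) : Prop :=
  ∀ i : ℕ, 1 ≤ i →
    CondIndepRV μ (fun ω => (X i ω, Y i ω, Z i ω))
      (fun ω => (blk X 1 (i - d - 1) ω, blk Y 1 (i - d - 1) ω, blk Z 1 (i - d - 1) ω))
      (past X Y Z d i)

/-- `(X, Y, Z)` are jointly stationary: all finite-dimensional joint distributions are
invariant under index shifts. -/
def JointlyStationary [MeasurableSpace Ω] (μ : Measure Ω) (X : ℕ → Ω → 𝒳) (Y : ℕ → Ω → 𝒴)
    (Z : ℕ → Ω → 𝒵) : Prop :=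
  ∀ (n : ℕ) (t : Fin n → ℕ) (a : Fin n → 𝒳 × 𝒴 × 𝒵), (∀ j, 1 ≤ t j) →
    μ (⋂ j, {ω | (X (t j) ω, Y (t j) ω, Z (t j) ω) = a j})
      = μ (⋂ j, {ω | (X (t j + 1) ω, Y (t j + 1) ω, Z (t j + 1) ω) = a j})

/-- Assumption (A1): for every `i`, the variables `X_i, Y_i, Z_i` are mutually conditionally
independent given the joint past `(X_{i-d}^{i-1}, Y_{i-d}^{i-1}, Z_{i-d}^{i-1})` (all pairwise
factorizations together with the triple factorization). -/
def A1 [MeasurableSpace Ω] (μ : Measure Ω) (X : ℕ → Ω → 𝒳) (Y : ℕ → Ω → 𝒴)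
    (Z : ℕ → Ω → 𝒵) (d : ℕ) : Prop :=
  ∀ i : ℕ, 1 ≤ i →
    CondIndepRV μ (X i) (Y i) (past X Y Z d i) ∧
    CondIndepRV μ (X i) (Z i) (past X Y Z d i) ∧
    CondIndepRV μ (Y i) (Z i) (past X Y Z d i) ∧
    ∀ (a : 𝒳) (b : 𝒴) (c : 𝒵)
      (w : (ℕ → Option 𝒳) × (ℕ → Option 𝒴) × (ℕ → Option 𝒵)),
      μ (X i ⁻¹' {a} ∩ Y i ⁻¹' {b} ∩ Z i ⁻¹' {c} ∩ past X Y Z d i ⁻¹' {w})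
          * μ (past X Y Z d i ⁻¹' {w}) * μ (past X Y Z d i ⁻¹' {w})
        = μ (X i ⁻¹' {a} ∩ past X Y Z d i ⁻¹' {w})
          * μ (Y i ⁻¹' {b} ∩ past X Y Z d i ⁻¹' {w})
          * μ (Z i ⁻¹' {c} ∩ past X Y Z d i ⁻¹' {w})

/-- The causally conditioned directed information
`I(Y^n → X^n ‖ Z^n) = ∑_{i=1}^n I(X_i ; Y^i ∣ X^{i-1}, Z^i)`. -/
def DI [MeasurableSpace Ω] (μ : Measure Ω) (X : ℕ → Ω → 𝒳) (Y : ℕ → Ω → 𝒴)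
    (Z : ℕ → Ω → 𝒵) (n : ℕ) : ℝ :=
  ∑ i ∈ Finset.Icc 1 n,
    cmi μ (X i) (blk Y 1 i) (fun ω => (blk X 1 (i - 1) ω, blk Z 1 i ω))

/-- The `k`-th order causally conditioned truncated directed information
`I_T^{(k)}(Y^n → X^n ‖ Z^n) = ∑_{i=1}^n I(X_i ; Y_{i-k}^i ∣ X_{i-k}^{i-1}, Z_{i-k}^i)`. -/
def TDI [MeasurableSpace Ω] (μ : Measure Ω) (X : ℕ → Ω → 𝒳) (Y : ℕ → Ω → 𝒴)
    (Z : ℕ → Ω → 𝒵) (k n : ℕ) : ℝ :=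
  ∑ i ∈ Finset.Icc 1 n,
    cmi μ (X i) (blk Y (i - k) i)
      (fun ω => (blk X (i - k) (i - 1) ω, blk Z (i - k) i ω))

/-- The `k`-th order causally conditioned partial directed information
`I_P^{(k)}(Y^n → X^n ‖ Z^n) = ∑_{i=1}^n I(X_i ; Y_{i-k}^i ∣ X^{i-1}, Y^{i-k-1}, Z^i)`. -/
def PDI [MeasurableSpace Ω] (μ : Measure Ω) (X : ℕ → Ω → 𝒳) (Y : ℕ → Ω → 𝒴)
    (Z : ℕ → Ω → 𝒵) (k n : ℕ) : ℝ :=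
  ∑ i ∈ Finset.Icc 1 n,
    cmi μ (X i) (blk Y (i - k) i)
      (fun ω => (blk X 1 (i - 1) ω, blk Y 1 (i - k - 1) ω, blk Z 1 i ω))

/-- `U` is a simple random variable: finitely many values, each attained on a measurable set. -/
def IsSimple [MeasurableSpace Ω] {β : Type*} (U : Ω → β) : Prop :=
  ∃ f : SimpleFunc Ω β, ⇑f = U

section Simple

variable [MeasurableSpace Ω] {β γ δ : Type*} {U : Ω → β} {V : Ω → γ}

lemma IsSimple.comp (hU : IsSimple U) (g : β → γ) : IsSimple (fun ω => g (U ω)) := by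
  obtain ⟨f, rfl⟩ := hU
  exact ⟨f.map g, rfl⟩

lemma IsSimple.prodMk (hU : IsSimple U) (hV : IsSimple V) :
    IsSimple (fun ω => (U ω, V ω)) := by
  obtain ⟨f, rfl⟩ := hU
  obtain ⟨g, rfl⟩ := hV
  exact ⟨f.pair g, rfl⟩

lemma IsSimple.finite_range (hU : IsSimple U) : (Set.range U).Finite := by
  obtain ⟨f, rfl⟩ := hU
  exact f.finite_range

lemma IsSimple.measurableSet_preimage (hU : IsSimple U) (s : Set β) :
    MeasurableSet (U ⁻¹' s) := by
  obtain ⟨f, rfl⟩ := hU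
  exact f.measurableSet_preimage s

lemma IsSimple.of_measurable [MeasurableSpace β] [MeasurableSingletonClass β] [Finite β]
    (hU : Measurable U) : IsSimple U :=
  ⟨⟨U, fun b => hU (measurableSet_singleton b), Set.toFinite _⟩, rfl⟩

lemma isSimple_blk [MeasurableSpace β] [MeasurableSingletonClass β] [Finite β]
    {X : ℕ → Ω → β} (hX : ∀ i, Measurable (X i)) (a b : ℕ) : IsSimple (blk X a b) := by
  have h : IsSimple (fun ω (j : Fin (b + 1)) => X j ω) :=
    .of_measurable (measurable_pi_lambda _ fun j => hX j)
  convert h.comp (fun x j => if h : max a 1 ≤ j ∧ j ≤ b then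
    some (x ⟨j, Nat.lt_succ_of_le h.2⟩) else none) using 3 with ω j
  simp only [blk, dite_eq_ite]

end Simple

lemma blk_eq_iff {α : Type*} {X : ℕ → Ω → α} {a b : ℕ} {ω ω' : Ω} :
    blk X a b ω = blk X a b ω' ↔ ∀ j, a ≤ j → 1 ≤ j → j ≤ b → X j ω = X j ω' := by
  simp only [blk, funext_iff]
  refine forall_congr' fun j => ?_
  split_ifs with h
  · rw [max_le_iff] at h
    simp [h]
  · rw [max_le_iff] at h
    grind

/-- The mutual information of a finite array with its marginals, as a single sum. -/
lemma sum_mul_log_marginals {A B C : Type*} [Fintype A] [Fintype B] [Fintype C]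
    {p : A → B → C → ℝ} {r : A → C → ℝ} {s : B → C → ℝ} {t : C → ℝ}
    (hr : ∀ a c, ∑ b, p a b c = r a c) (hs : ∀ b c, ∑ a, p a b c = s b c)
    (ht : ∀ c, ∑ a, r a c = t c) :
    ∑ c, ∑ a, ∑ b, p a b c *
        (Real.log (p a b c) + Real.log (t c) - Real.log (r a c) - Real.log (s b c))
      = ∑ a, ∑ b, ∑ c, p a b c * Real.log (p a b c) + ∑ c, t c * Real.log (t c)
        - ∑ a, ∑ c, r a c * Real.log (r a c) - ∑ b, ∑ c, s b c * Real.log (s b c) := by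
  have hp : ∑ a, ∑ b, ∑ c, p a b c * Real.log (p a b c)
      = ∑ c, ∑ a, ∑ b, p a b c * Real.log (p a b c) := by
    rw [Finset.sum_comm]
    simp_rw [Finset.sum_comm (s := (univ : Finset A)) (t := (univ : Finset C))]
    rw [Finset.sum_comm]
    exact Finset.sum_congr rfl fun c _ => Finset.sum_comm
  rw [hp, Finset.sum_comm (s := (univ : Finset A)) (t := (univ : Finset C)),
    Finset.sum_comm (s := (univ : Finset B)) (t := (univ : Finset C)),
    ← Finset.sum_add_distrib, ← Finset.sum_sub_distrib, ← Finset.sum_sub_distrib]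
  refine Finset.sum_congr rfl fun c _ => ?_
  have hs' : ∑ b, s b c * Real.log (s b c) = ∑ a, ∑ b, p a b c * Real.log (s b c) := by
    rw [Finset.sum_comm]
    simp_rw [← hs, Finset.sum_mul]
  have hr' : ∑ a, r a c * Real.log (r a c) = ∑ a, ∑ b, p a b c * Real.log (r a c) := by
    simp_rw [← hr, Finset.sum_mul]
  have ht' : t c * Real.log (t c) = ∑ a, ∑ b, p a b c * Real.log (t c) := by
    simp_rw [← Finset.sum_mul, hr, ht]
  rw [hs', hr', ht']
  simp only [← Finset.sum_add_distrib, ← Finset.sum_sub_distrib]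
  refine Finset.sum_congr rfl fun a _ => Finset.sum_congr rfl fun b _ => ?_
  ring

/-- Pointwise form of Gibbs' inequality for a product of marginals. -/
lemma sub_div_le_mul_log {p r s t : ℝ} (hp : 0 ≤ p) (hpr : p ≤ r) (hps : p ≤ s) (hrt : r ≤ t) :
    p - r * s / t ≤ p * (Real.log p + Real.log t - Real.log r - Real.log s) := by
  rcases hp.eq_or_lt with rfl | hp
  · have : 0 ≤ r * s / t := div_nonneg (mul_nonneg hpr hps) (hpr.trans hrt)
    simpa using this
  have hr := hp.trans_le hpr
  have hs := hp.trans_le hps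
  have ht := hr.trans_le hrt
  have key := Real.one_sub_inv_le_log_of_pos (x := p * t / (r * s)) (by positivity)
  rw [Real.log_div (by positivity) (by positivity), Real.log_mul hp.ne' ht.ne',
    Real.log_mul hr.ne' hs.ne', ← sub_sub] at key
  refine le_trans (le_of_eq ?_) (mul_le_mul_of_nonneg_left key hp.le)
  field_simp

/-- Strong subadditivity of entropy for a finite array. -/
lemma sum_mul_log_marginals_nonneg {A B C : Type*} [Fintype A] [Fintype B] [Fintype C]
    {p : A → B → C → ℝ} {r : A → C → ℝ} {s : B → C → ℝ} {t : C → ℝ}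
    (hp : ∀ a b c, 0 ≤ p a b c) (hr : ∀ a c, ∑ b, p a b c = r a c)
    (hs : ∀ b c, ∑ a, p a b c = s b c) (ht : ∀ c, ∑ a, r a c = t c) :
    0 ≤ ∑ c, ∑ a, ∑ b, p a b c *
        (Real.log (p a b c) + Real.log (t c) - Real.log (r a c) - Real.log (s b c)) := by
  refine Finset.sum_nonneg fun c _ => ?_
  have hr0 : ∀ a, 0 ≤ r a c := fun a => hr a c ▸ Finset.sum_nonneg fun b _ => hp a b c
  have hst : ∑ b, s b c = t c := by
    simp_rw [← hs, ← ht, ← hr]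
    exact Finset.sum_comm
  calc (0 : ℝ) = t c - t c * t c / t c := by rw [mul_self_div_self, sub_self]
    _ = ∑ a, ∑ b, (p a b c - r a c * s b c / t c) := by
      simp_rw [Finset.sum_sub_distrib, hr, ht, ← Finset.sum_div, ← Finset.mul_sum,
        ← Finset.sum_mul, hst, ht]
    _ ≤ _ := Finset.sum_le_sum fun a _ => Finset.sum_le_sum fun b _ =>
      sub_div_le_mul_log (hp a b c)
        (hr a c ▸ Finset.single_le_sum (f := fun b => p a b c) (fun b _ => hp a b c) (mem_univ b))
        (hs b c ▸ Finset.single_le_sum (f := fun a => p a b c) (fun a _ => hp a b c) (mem_univ a))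
        (ht c ▸ Finset.single_le_sum (f := fun a => r a c) (fun a _ => hr0 a) (mem_univ a))

lemma rangeFactorization_eq_iff {β : Type*} (U : Ω → β) (ω ω' : Ω) :
    U ω = U ω' ↔ Set.rangeFactorization U ω = Set.rangeFactorization U ω' := by
  simp [Set.rangeFactorization]

lemma preimage_rangeFactorization_singleton {β : Type*} (U : Ω → β) (b : Set.range U) :
    Set.rangeFactorization U ⁻¹' {b} = U ⁻¹' {b.1} := by
  ext ω
  simp [Set.rangeFactorization, Subtype.ext_iff]

section Entropy

variable [MeasurableSpace Ω] {μ : Measure Ω} {β γ δ : Type*}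
  {U : Ω → β} {V : Ω → γ} {W : Ω → δ}

lemma ent_comp_injective {g : β → γ} (hg : Function.Injective g) (U : Ω → β) :
    ent μ (fun ω => g (U ω)) = ent μ U := by
  unfold ent
  rw [← hg.tsum_eq]
  · simp only [Set.preimage, Set.mem_singleton_iff, hg.eq_iff]
  · intro c hc
    by_contra hcg
    refine hc ?_
    have : (fun ω => g (U ω)) ⁻¹' {c} = ∅ := by
      ext ω
      simpa using fun h => hcg ⟨U ω, h⟩
    simp [this]

lemma ent_eq_ent_mk_ker (U : Ω → β) :
    ent μ U = ent μ (fun ω => Quotient.mk (Setoid.ker U) ω) :=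
  ent_comp_injective (Setoid.kerLift_injective U) fun ω => Quotient.mk (Setoid.ker U) ω

/-- Entropy only depends on the partition induced by the random variable. -/
lemma ent_congr (h : ∀ ω ω', U ω = U ω' ↔ V ω = V ω') : ent μ U = ent μ V := by
  have hk : Setoid.ker U = Setoid.ker V := Setoid.ext h
  rw [ent_eq_ent_mk_ker U, ent_eq_ent_mk_ker V, hk]

lemma condEnt_congr (hU : ∀ ω ω', U ω = U ω' ↔ V ω = V ω') {ε : Type*} {W' : Ω → ε}
    (hW : ∀ ω ω', W ω = W ω' ↔ W' ω = W' ω') : condEnt μ U W = condEnt μ V W' := by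
  unfold condEnt
  rw [ent_congr (U := W) hW, ent_congr (V := fun ω => (V ω, W' ω))]
  simp [hU, hW]

lemma sum_measureReal_preimage_singleton_inter [IsFiniteMeasure μ] [Fintype β]
    (hU : IsSimple U) (s : Set Ω) : ∑ b, μ.real (U ⁻¹' {b} ∩ s) = μ.real s := by
  have h := sum_measureReal_preimage_singleton (μ := μ.restrict s) univ (f := U)
    fun b _ => hU.measurableSet_preimage {b}
  simpa [measureReal_restrict_apply (hU.measurableSet_preimage _)] using h

lemma sum_measureReal_inter_preimage_singleton_inter [IsFiniteMeasure μ] [Fintype β]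
    (hU : IsSimple U) (s t : Set Ω) : ∑ b, μ.real (s ∩ U ⁻¹' {b} ∩ t) = μ.real (s ∩ t) := by
  simp_rw [Set.inter_comm s (U ⁻¹' _), Set.inter_assoc]
  exact sum_measureReal_preimage_singleton_inter hU _

/-- Conditional mutual information of finitely-valued random variables, as a single sum. -/
lemma condEnt_sub_condEnt_eq_sum [IsFiniteMeasure μ] [Fintype β] [Fintype γ] [Fintype δ]
    (hU : IsSimple U) (hV : IsSimple V) :
    condEnt μ U W - condEnt μ U (fun ω => (V ω, W ω)) =
      ∑ w, ∑ u, ∑ v, μ.real (U ⁻¹' {u} ∩ V ⁻¹' {v} ∩ W ⁻¹' {w}) *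
        (Real.log (μ.real (U ⁻¹' {u} ∩ V ⁻¹' {v} ∩ W ⁻¹' {w})) + Real.log (μ.real (W ⁻¹' {w}))
          - Real.log (μ.real (U ⁻¹' {u} ∩ W ⁻¹' {w}))
          - Real.log (μ.real (V ⁻¹' {v} ∩ W ⁻¹' {w}))) := by
  rw [sum_mul_log_marginals (p := fun u v w => μ.real (U ⁻¹' {u} ∩ V ⁻¹' {v} ∩ W ⁻¹' {w}))
    (r := fun u w => μ.real (U ⁻¹' {u} ∩ W ⁻¹' {w}))
    (s := fun v w => μ.real (V ⁻¹' {v} ∩ W ⁻¹' {w})) (t := fun w => μ.real (W ⁻¹' {w}))]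
  · simp only [condEnt, ent, tsum_fintype, Fintype.sum_prod_type, ← Set.singleton_prod_singleton,
      Set.mk_preimage_prod, Set.inter_assoc, measureReal_def]
    ring
  · intro u w
    exact sum_measureReal_inter_preimage_singleton_inter hV _ _
  · intro v w
    simp_rw [Set.inter_assoc]
    exact sum_measureReal_preimage_singleton_inter hU _
  · intro w
    exact sum_measureReal_preimage_singleton_inter hU _

lemma IsSimple.rangeFactorization (hU : IsSimple U) : IsSimple (Set.rangeFactorization U) := by
  obtain ⟨f, rfl⟩ := hU
  refine ⟨⟨_, fun b => ?_, ?_⟩, rfl⟩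
  · simpa [Set.preimage, Set.rangeFactorization, Subtype.ext_iff]
      using f.measurableSet_preimage {b.1}
  · have := f.finite_range.to_subtype
    exact Set.toFinite _

lemma condEnt_sub_condEnt_rangeFactorization (U : Ω → β) (V : Ω → γ) (W : Ω → δ) :
    condEnt μ U W - condEnt μ U (fun ω => (V ω, W ω)) =
      condEnt μ (Set.rangeFactorization U) (Set.rangeFactorization W) -
        condEnt μ (Set.rangeFactorization U)
          (fun ω => (Set.rangeFactorization V ω, Set.rangeFactorization W ω)) := by
  congr 1 <;> refine condEnt_congr (rangeFactorization_eq_iff U) fun ω ω' => ?_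
  · exact rangeFactorization_eq_iff W ω ω'
  · simp only [Prod.mk.injEq, ← rangeFactorization_eq_iff]

/-- Conditioning reduces entropy. -/
lemma condEnt_prodMk_le [IsFiniteMeasure μ]
    (hU : IsSimple U) (hV : IsSimple V) (hW : IsSimple W) :
    condEnt μ U (fun ω => (V ω, W ω)) ≤ condEnt μ U W := by
  have := hU.finite_range.fintype
  have := hV.finite_range.fintype
  have := hW.finite_range.fintype
  have hU' := hU.rangeFactorization
  have hV' := hV.rangeFactorization
  rw [← sub_nonneg, condEnt_sub_condEnt_rangeFactorization, condEnt_sub_condEnt_eq_sum hU' hV']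
  refine sum_mul_log_marginals_nonneg
    (p := fun u v w => μ.real (Set.rangeFactorization U ⁻¹' {u} ∩
      Set.rangeFactorization V ⁻¹' {v} ∩ Set.rangeFactorization W ⁻¹' {w}))
    (r := fun u w => μ.real (Set.rangeFactorization U ⁻¹' {u} ∩
      Set.rangeFactorization W ⁻¹' {w}))
    (s := fun v w => μ.real (Set.rangeFactorization V ⁻¹' {v} ∩
      Set.rangeFactorization W ⁻¹' {w}))
    (t := fun w => μ.real (Set.rangeFactorization W ⁻¹' {w}))
    (fun _ _ _ => measureReal_nonneg) (fun u w => ?_) (fun v w => ?_) fun w => ?_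
  · exact sum_measureReal_inter_preimage_singleton_inter hV' _ _
  · simp_rw [Set.inter_assoc]
    exact sum_measureReal_preimage_singleton_inter hU' _
  · exact sum_measureReal_preimage_singleton_inter hU' _

/-- Conditioning on a finer random variable reduces entropy. -/
lemma condEnt_anti [IsFiniteMeasure μ] (hU : IsSimple U) (hV : IsSimple V) (hW : IsSimple W)
    (h : ∀ ω ω', V ω = V ω' → W ω = W ω') : condEnt μ U V ≤ condEnt μ U W := by
  refine le_trans (le_of_eq ?_) (condEnt_prodMk_le hU hV hW)
  refine condEnt_congr (fun _ _ => Iff.rfl) fun ω ω' => ?_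
  simpa using h ω ω'

lemma CondIndepRV.condEnt_prodMk_eq [IsFiniteMeasure μ] (h : CondIndepRV μ U V W)
    (hU : IsSimple U) (hV : IsSimple V) (hW : IsSimple W) :
    condEnt μ U (fun ω => (V ω, W ω)) = condEnt μ U W := by
  have := hU.finite_range.fintype
  have := hV.finite_range.fintype
  have := hW.finite_range.fintype
  rw [eq_comm, ← sub_eq_zero, condEnt_sub_condEnt_rangeFactorization,
    condEnt_sub_condEnt_eq_sum hU.rangeFactorization hV.rangeFactorization]
  refine Finset.sum_eq_zero fun w _ => Finset.sum_eq_zero fun u _ => Finset.sum_eq_zero fun v _ => ?_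
  simp only [preimage_rangeFactorization_singleton]
  have hreal := congrArg ENNReal.toReal (h u.1 v.1 w.1)
  simp only [ENNReal.toReal_mul, ← measureReal_def] at hreal
  rcases eq_or_ne (μ.real (U ⁻¹' {u.1} ∩ V ⁻¹' {v.1} ∩ W ⁻¹' {w.1})) 0 with h0 | h0
  · simp [h0]
  have hw : μ.real (W ⁻¹' {w.1}) ≠ 0 := fun hw =>
    h0 (measureReal_mono_null Set.inter_subset_right hw)
  have hne := hreal ▸ mul_ne_zero h0 hw
  have hlog := congrArg Real.log hreal
  rw [Real.log_mul h0 hw, Real.log_mul (left_ne_zero_of_mul hne) (right_ne_zero_of_mul hne)]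
    at hlog
  rw [hlog]
  ring

end Entropy

lemma past_eq_iff {X : ℕ → Ω → 𝒳} {Y : ℕ → Ω → 𝒴} {Z : ℕ → Ω → 𝒵} {d i : ℕ} {ω ω' : Ω} :
    past X Y Z d i ω = past X Y Z d i ω' ↔
      ∀ j, i - d ≤ j → 1 ≤ j → j ≤ i - 1 →
        X j ω = X j ω' ∧ Y j ω = Y j ω' ∧ Z j ω = Z j ω' := by
  simp only [past, Prod.mk.injEq, blk_eq_iff]
  grind

/-- Chain rule separating the present of `Y` and `Z` from the joint past. -/
lemma condEnt_window_eq [MeasurableSpace Ω] {μ : Measure Ω}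
    (X : ℕ → Ω → 𝒳) (Y : ℕ → Ω → 𝒴) (Z : ℕ → Ω → 𝒵)
    {i : ℕ} (hi : 1 ≤ i) (k : ℕ) :
    condEnt μ (X i) (fun ω => (blk Y (i - k) i ω, blk X (i - k) (i - 1) ω, blk Z (i - k) i ω))
      = condEnt μ (fun ω => (X i ω, Y i ω, Z i ω)) (past X Y Z k i)
        - condEnt μ (fun ω => (Y i ω, Z i ω)) (past X Y Z k i) := by
  simp only [condEnt, sub_sub_sub_cancel_right]
  have hsplit : ∀ j, j ≤ i ↔ j ≤ i - 1 ∨ j = i := by omega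
  congr 1 <;> refine ent_congr fun ω ω' => ?_ <;>
    simp only [Prod.mk.injEq, blk_eq_iff, past_eq_iff] <;> grind

section Processes

variable [MeasurableSpace Ω] {μ : Measure Ω} [IsFiniteMeasure μ]
  [MeasurableSpace 𝒳] [MeasurableSingletonClass 𝒳] [Finite 𝒳]
  [MeasurableSpace 𝒴] [MeasurableSingletonClass 𝒴] [Finite 𝒴]
  [MeasurableSpace 𝒵] [MeasurableSingletonClass 𝒵] [Finite 𝒵]
  {X : ℕ → Ω → 𝒳} {Y : ℕ → Ω → 𝒴} {Z : ℕ → Ω → 𝒵}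

lemma isSimple_past (hX : ∀ i, Measurable (X i)) (hY : ∀ i, Measurable (Y i))
    (hZ : ∀ i, Measurable (Z i)) (d i : ℕ) : IsSimple (past X Y Z d i) :=
  (isSimple_blk hX _ _).prodMk ((isSimple_blk hY _ _).prodMk (isSimple_blk hZ _ _))

/-- For a jointly `d`-Markov process, discarding all but the last `k ≥ d` samples from the
conditioning does not increase the entropy of `X i`. -/
lemma JointlyMarkov.condEnt_window_le {d : ℕ} (hmarkov : JointlyMarkov μ X Y Z d)
    (hX : ∀ i, Measurable (X i)) (hY : ∀ i, Measurable (Y i)) (hZ : ∀ i, Measurable (Z i))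
    {i k : ℕ} (hi : 1 ≤ i) (hk : d ≤ k) :
    condEnt μ (X i) (fun ω => (blk Y (i - k) i ω, blk X (i - k) (i - 1) ω, blk Z (i - k) i ω))
      ≤ condEnt μ (X i) (fun ω => (blk Y 1 i ω, blk X 1 (i - 1) ω, blk Z 1 i ω)) := by
  have hfull := condEnt_window_eq (μ := μ) X Y Z hi (i - 1)
  rw [Nat.sub_sub_self hi] at hfull
  rw [hfull, condEnt_window_eq X Y Z hi]
  have sYZ : IsSimple (fun ω => (Y i ω, Z i ω)) :=
    (IsSimple.of_measurable (hY i)).prodMk (.of_measurable (hZ i))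
  have sT : IsSimple (fun ω => (X i ω, Y i ω, Z i ω)) :=
    (IsSimple.of_measurable (hX i)).prodMk sYZ
  have sP := isSimple_past hX hY hZ
  have hci := (hmarkov i hi).condEnt_prodMk_eq sT ((isSimple_blk hX _ _).prodMk
    ((isSimple_blk hY _ _).prodMk (isSimple_blk hZ _ _))) (sP d i)
  have hpast : condEnt μ (fun ω => (X i ω, Y i ω, Z i ω)) (past X Y Z d i)
      = condEnt μ (fun ω => (X i ω, Y i ω, Z i ω)) (past X Y Z (i - 1) i) := by
    rw [← hci]
    refine condEnt_congr (fun _ _ => Iff.rfl) fun ω ω' => ?_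
    simp only [Prod.mk.injEq, blk_eq_iff, past_eq_iff]
    grind
  have hT : condEnt μ (fun ω => (X i ω, Y i ω, Z i ω)) (past X Y Z k i)
      ≤ condEnt μ (fun ω => (X i ω, Y i ω, Z i ω)) (past X Y Z d i) := by
    refine condEnt_anti sT (sP k i) (sP d i) fun ω ω' h => ?_
    rw [past_eq_iff] at h ⊢
    exact fun j hj => h j (by omega)
  have hYZ : condEnt μ (fun ω => (Y i ω, Z i ω)) (past X Y Z (i - 1) i)
      ≤ condEnt μ (fun ω => (Y i ω, Z i ω)) (past X Y Z k i) := by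
    refine condEnt_anti sYZ (sP (i - 1) i) (sP k i) fun ω ω' h => ?_
    rw [past_eq_iff] at h ⊢
    exact fun j _ hj => h j (by omega) hj
  linarith

end Processes

/-- finite-horizon form of Theorem 3. If `(X, Y, Z)` are jointly
stationary and jointly `d`-Markov, then for every `n ≥ 1`, `k₁ ≥ 1`, and `k₂ ≥ d`,
`I_P^{(k₁)}(Y^n → X^n ‖ Z^n) ≤ I(Y^n → X^n ‖ Z^n) ≤ I_T^{(k₂)}(Y^n → X^n ‖ Z^n)`. -/
theorem pdi_le_di_le_tdi
    [MeasurableSpace Ω] (μ : Measure Ω) [IsProbabilityMeasure μ]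
    [MeasurableSpace 𝒳] [MeasurableSingletonClass 𝒳] [Fintype 𝒳]
    [MeasurableSpace 𝒴] [MeasurableSingletonClass 𝒴] [Fintype 𝒴]
    [MeasurableSpace 𝒵] [MeasurableSingletonClass 𝒵] [Fintype 𝒵]
    (X : ℕ → Ω → 𝒳) (Y : ℕ → Ω → 𝒴) (Z : ℕ → Ω → 𝒵)
    (hX : ∀ i, Measurable (X i)) (hY : ∀ i, Measurable (Y i))
    (hZ : ∀ i, Measurable (Z i)) (d : ℕ)
    (hstat : JointlyStationary μ X Y Z)
    (hmarkov : JointlyMarkov μ X Y Z d) :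
    ∀ (n k₁ k₂ : ℕ), 1 ≤ n → 1 ≤ k₁ → d ≤ k₂ →
      PDI μ X Y Z k₁ n ≤ DI μ X Y Z n ∧ DI μ X Y Z n ≤ TDI μ X Y Z k₂ n := by
  intro n k₁ k₂ _ _ hk₂
  have sX := fun i => IsSimple.of_measurable (hX i)
  have bX := isSimple_blk hX
  have bY := isSimple_blk hY
  have bZ := isSimple_blk hZ
  constructor
  · refine Finset.sum_le_sum fun i _ => sub_le_sub ?_ (le_of_eq ?_)
    · refine condEnt_anti (sX i) ((bX _ _).prodMk ((bY _ _).prodMk (bZ _ _)))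
        ((bX _ _).prodMk (bZ _ _)) fun ω ω' h => ?_
      simp only [Prod.mk.injEq] at h ⊢
      exact ⟨h.1, h.2.2⟩
    · refine condEnt_congr (fun _ _ => Iff.rfl) fun ω ω' => ?_
      simp only [Prod.mk.injEq, blk_eq_iff]
      grind
  · refine Finset.sum_le_sum fun i hi => sub_le_sub ?_
      (hmarkov.condEnt_window_le hX hY hZ (Finset.mem_Icc.1 hi).1 hk₂)
    refine condEnt_anti (sX i) ((bX _ _).prodMk (bZ _ _)) ((bX _ _).prodMk (bZ _ _))
      fun ω ω' h => ?_
    simp only [Prod.mk.injEq, blk_eq_iff] at h ⊢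
    exact ⟨fun j _ hj => h.1 j hj hj, fun j _ hj => h.2 j hj hj⟩
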